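/- Let β ∈ {1,2,4}, N ≥ 1 an integer, r > 0, and set N_β = N + βN(N−1)/2. For every bounded measurable function h : ℝ^N → ℝ, the bounded trace and fixed trace ensemble averages satisfy E_θ[h] = ∫_0^r (N_β/r^{N_β}) u^{N_β−1} E_δ[h((u/r)·)] du, where E_θ[h] = ∫_{ℝ^N} h(x) P^{BT,r}_{Nβ}(x) dx and E_δ[g] = ∫ g dP^{FT,r}_{Nβ} denotes the average of g against the fixed trace density on the sphere of radius r, and h((u/r)·) denotes x ↦ h((u/r)x). -/

import Mathlib

open MeasureTheory Filter Real Topology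

noncomputable section

/-- The β-Vandermonde factor `∏_{j<k} |x_j - x_k|^β`. -/
def vand (β : ℝ) (N : ℕ) (x : Fin N → ℝ) : ℝ :=
  ∏ p ∈ Finset.univ.filter (fun p : Fin N × Fin N => p.1 < p.2), |x p.1 - x p.2| ^ β

/-- `N_β = N + βN(N-1)/2`. -/
def Nbeta (β : ℝ) (N : ℕ) : ℝ := N + β * N * (N - 1) / 2

/-- Surface (Hausdorff) measure on the sphere of radius `r` in Euclidean `ℝ^N`. -/
def sphereMeasure (N : ℕ) (r : ℝ) : Measure (EuclideanSpace ℝ (Fin N)) :=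
  (μH[(N : ℝ) - 1]).restrict (Metric.sphere (0 : EuclideanSpace ℝ (Fin N)) r)

/-- Normalization of the fixed trace ensemble: total `Δ_β`-mass of the sphere of radius `r`. -/
def Zft (β : ℝ) (N : ℕ) (r : ℝ) : ℝ :=
  ∫ x, vand β N x ∂(sphereMeasure N r)

/-- Glue `(x_1,…,x_n)` and `(x_{n+1},…,x_N)` into a vector in `ℝ^N`. -/
def combine (N n : ℕ) (x : Fin n → ℝ) (y : Fin (N - n) → ℝ) : Fin N → ℝ := fun i =>
  if h : (i : ℕ) < n then x ⟨i, h⟩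
  else y ⟨(i : ℕ) - n, by have := i.isLt; omega⟩

/-- `n`-point correlation function of the fixed trace Gaussian β-ensemble of strength `r`. -/
def Rft (β : ℝ) (n N : ℕ) (r : ℝ) (x : Fin n → ℝ) : ℝ :=
  ((N.factorial : ℝ) / ((N - n).factorial : ℝ)) * (Zft β N r)⁻¹ *
    ∫ y, vand β N (combine N n x y)
      ∂(sphereMeasure (N - n) (Real.sqrt (r ^ 2 - ∑ i, x i ^ 2)))

/-- Normalization of the bounded trace ensemble. -/
def Zbt (β : ℝ) (N : ℕ) (r : ℝ) : ℝ :=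
  ∫ x : Fin N → ℝ, Set.indicator {z : Fin N → ℝ | ∑ i, z i ^ 2 ≤ r ^ 2} (vand β N) x

/-- `n`-point correlation function of the bounded trace Gaussian β-ensemble of strength `r`. -/
def Rbt (β : ℝ) (n N : ℕ) (r : ℝ) (x : Fin n → ℝ) : ℝ :=
  ((N.factorial : ℝ) / ((N - n).factorial : ℝ)) * (Zbt β N r)⁻¹ *
    ∫ y : Fin (N - n) → ℝ,
      Set.indicator {z : Fin N → ℝ | ∑ i, z i ^ 2 ≤ r ^ 2} (vand β N) (combine N n x y)

/-- Normalization of the (unconstrained) Gaussian β-ensemble. -/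
def Zg (β : ℝ) (N : ℕ) : ℝ :=
  ∫ x : Fin N → ℝ, vand β N x * ∏ i, Real.exp (-(β * N * x i ^ 2))

/-- `n`-point correlation function of the Gaussian β-ensemble. -/
def Rg (β : ℝ) (n N : ℕ) (x : Fin n → ℝ) : ℝ :=
  ((N.factorial : ℝ) / ((N - n).factorial : ℝ)) * (Zg β N)⁻¹ *
    ∫ y : Fin (N - n) → ℝ,
      vand β N (combine N n x y) * ∏ i, Real.exp (-(β * N * (combine N n x y i) ^ 2))

/-- The sine kernel `sin(π(x-y))/(π(x-y))`, with value `1` on the diagonal. -/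
def Ksine (x y : ℝ) : ℝ :=
  if x = y then 1 else Real.sin (π * (x - y)) / (π * (x - y))

/-- `S(t) = sin(πt)/(πt)` with `S(0) = 1`. -/
def Ssin (t : ℝ) : ℝ := if t = 0 then 1 else Real.sin (π * t) / (π * t)

/-- The 2×2 matrix sine kernel for β = 1. -/
def K1sine (x y : ℝ) : Fin 2 → Fin 2 → ℝ :=
  ![![Ssin (x - y), deriv Ssin (x - y)],
    ![(∫ t in (0:ℝ)..(x - y), Ssin t) - Real.sign (x - y) / 2, Ssin (x - y)]]

/-- The 2×2 matrix sine kernel for β = 4. -/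
def K4sine (x y : ℝ) : Fin 2 → Fin 2 → ℝ :=
  ![![Ssin (2 * (x - y)), deriv (fun z => Ssin (2 * (z - y))) x],
    ![(∫ t in (0:ℝ)..(x - y), Ssin (2 * t)) - Real.sign (2 * (x - y)) / 2,
      Ssin (2 * (x - y))]]

/-- The Airy function `Ai(x) = lim_{T→∞} (1/π) ∫_0^T cos(t³/3 + xt) dt`. -/
def Ai (x : ℝ) : ℝ :=
  limUnder atTop (fun T : ℝ => (1 / π) * ∫ t in (0:ℝ)..T, Real.cos (t ^ 3 / 3 + x * t))

/-- The Airy kernel. -/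
def KAiry (x y : ℝ) : ℝ :=
  if x = y then (deriv Ai x) ^ 2 - x * (Ai x) ^ 2
  else (Ai x * deriv Ai y - deriv Ai x * Ai y) / (x - y)

/-- `C_{Nβ} = Γ(N_β/2)·2^{N_β/2−1}·β^{−N_β/2}`. -/
def Cnb (β : ℝ) (N : ℕ) : ℝ :=
  Real.Gamma (Nbeta β N / 2) * (2 : ℝ) ^ (Nbeta β N / 2 - 1) * β ^ (-(Nbeta β N) / 2)

end

lemma setLIntegral_measure_ball_comm {X : Type*} [PseudoMetricSpace X] [MeasurableSpace X]
    [BorelSpace X] [SecondCountableTopology X] (μ ν : Measure X) [IsFiniteMeasure μ]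
    [IsFiniteMeasure ν] {A : Set X} (hA : MeasurableSet A) (ε : ℝ) :
    ∫⁻ x in A, μ (Metric.ball x ε) ∂ν = ∫⁻ y, ν (A ∩ Metric.ball y ε) ∂μ := by
  have hT : MeasurableSet {p : X × X | p.1 ∈ A ∧ dist p.2 p.1 < ε} :=
    (measurable_fst hA).inter
      (isOpen_lt (continuous_snd.dist continuous_fst) continuous_const).measurableSet
  have h₁ := Measure.prod_apply (μ := ν) (ν := μ) hT
  rw [Measure.prod_apply_symm hT] at h₁
  rw [← lintegral_indicator hA]
  convert h₁.symm using 2 with x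
  · ext x
    by_cases hx : x ∈ A
    · simp [hx, Metric.ball]
    · simp [hx]
  · ext y
    congr 1
    ext x
    simp [dist_comm]

/-- One half of the uniqueness of uniformly distributed measures. -/
lemma measure_isOpen_mul_le_of_uniform_balls {X : Type*} [PseudoMetricSpace X] [MeasurableSpace X]
    [BorelSpace X] [SecondCountableTopology X] {μ ν : Measure X} [IsFiniteMeasure μ]
    [IsFiniteMeasure ν] {S : Set X} (hμS : ∀ᵐ x ∂μ, x ∈ S) (hνS : ∀ᵐ x ∂ν, x ∈ S)
    {g k : ℝ → ENNReal} (hμ : ∀ ε, ∀ x ∈ S, μ (Metric.ball x ε) = g ε)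
    (hν : ∀ ε, ∀ x ∈ S, ν (Metric.ball x ε) = k ε) {U : Set X} (hU : IsOpen U) :
    ν U * μ Set.univ ≤ μ U * ν Set.univ := by
  rcases eq_or_ne μ 0 with rfl | hμ0
  · simp
  have hne : S.Nonempty := by
    by_contra hS
    rw [Set.not_nonempty_iff_eq_empty] at hS
    subst hS
    exact hμ0 (by simpa [ae_iff] using hμS)
  have hg_top : ∀ ε, g ε ≠ ⊤ := fun ε => by
    obtain ⟨x, hx⟩ := hne
    rw [← hμ ε x hx]
    exact measure_ne_top _ _
  have hg_zero : ∀ ε, 0 < ε → g ε ≠ 0 := fun ε hε h0 => by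
    have hS0 : μ S = 0 := measure_null_of_locally_null S fun x hx =>
      ⟨Metric.ball x ε, mem_nhdsWithin_of_mem_nhds (Metric.ball_mem_nhds x hε), by
        rw [hμ ε x hx, h0]⟩
    apply hμ0
    rw [← Measure.measure_univ_eq_zero, ← Set.union_compl_self S]
    exact measure_union_null hS0 (ae_iff.1 hμS)
  have hμint : ∀ (ε : ℝ) (A : Set X), MeasurableSet A →
      ∫⁻ x in A, μ (Metric.ball x ε) ∂ν = g ε * ν A := fun ε A hA => by
    rw [setLIntegral_congr_fun_ae hA (g := fun _ => g ε)
      (hνS.mono fun x hx _ => hμ ε x hx)]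
    simp
  have hνint : ∀ (ε : ℝ) (A : Set X), MeasurableSet A →
      ∫⁻ x in A, ν (Metric.ball x ε) ∂μ = k ε * μ A := fun ε A hA => by
    rw [setLIntegral_congr_fun_ae hA (g := fun _ => k ε)
      (hμS.mono fun x hx _ => hν ε x hx)]
    simp
  have htotal : ∀ ε, g ε * ν Set.univ = k ε * μ Set.univ := fun ε => by
    rw [← hμint ε _ .univ, ← hνint ε _ .univ, setLIntegral_measure_ball_comm μ ν .univ]
    simp
  let V : ℕ → Set X := fun n => (Metric.thickening (1 / ((n : ℝ) + 1)) Uᶜ)ᶜ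
  have hVm : ∀ n, MeasurableSet (V n) := fun n => Metric.isOpen_thickening.measurableSet.compl
  have hVmono : Monotone V := fun m n hmn => Set.compl_subset_compl.2
    (Metric.thickening_mono (one_div_le_one_div_of_le (by positivity) (by gcongr)) _)
  have hVU : U ⊆ ⋃ n, V n := fun x hx => by
    obtain ⟨δ, hδ, hball⟩ := Metric.isOpen_iff.1 hU x hx
    obtain ⟨n, hn⟩ := exists_nat_one_div_lt hδ
    refine Set.mem_iUnion.2 ⟨n, fun hxt => ?_⟩
    obtain ⟨z, hz, hxz⟩ := Metric.mem_thickening_iff.1 hxt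
    exact hz (hball (by rw [Metric.mem_ball, dist_comm]; exact hxz.trans hn))
  have hV : ∀ n, ν (V n) * μ Set.univ ≤ μ U * ν Set.univ := fun n => by
    set ε : ℝ := 1 / ((n : ℝ) + 1) with hε
    have hεpos : 0 < ε := by positivity
    have hle : g ε * ν (V n) ≤ k ε * μ U := by
      rw [← hμint ε _ (hVm n), ← hνint ε _ hU.measurableSet,
        setLIntegral_measure_ball_comm μ ν (hVm n), ← lintegral_indicator hU.measurableSet]
      refine lintegral_mono fun y => ?_
      by_cases hy : y ∈ U
      · simpa [hy] using measure_mono Set.inter_subset_right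
      · have : V n ∩ Metric.ball y ε = ∅ := by
          ext x
          simp only [Set.mem_inter_iff, Set.mem_empty_iff_false, iff_false, not_and]
          exact fun hx hxy => hx (Metric.mem_thickening_iff.2 ⟨y, hy, hxy⟩)
        simp [this]
    rw [← ENNReal.mul_le_mul_iff_right (hg_zero ε hεpos) (hg_top ε)]
    calc g ε * (ν (V n) * μ Set.univ) = g ε * ν (V n) * μ Set.univ := by ring
      _ ≤ k ε * μ U * μ Set.univ := by gcongr
      _ = μ U * (k ε * μ Set.univ) := by ring
      _ = g ε * (μ U * ν Set.univ) := by rw [← htotal]; ring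
  calc ν U * μ Set.univ ≤ ν (⋃ n, V n) * μ Set.univ := by gcongr
    _ = ⨆ n, ν (V n) * μ Set.univ := by
      rw [hVmono.measure_iUnion, ENNReal.iSup_mul]
    _ ≤ _ := iSup_le hV

/-- Two finite measures carried by a set, each giving the same mass to all balls of equal radius
centred on that set, are proportional. -/
lemma measure_smul_eq_of_uniform_balls {X : Type*} [PseudoMetricSpace X] [MeasurableSpace X]
    [BorelSpace X] [SecondCountableTopology X] {μ ν : Measure X} [IsFiniteMeasure μ]
    [IsFiniteMeasure ν] {S : Set X} (hμS : ∀ᵐ x ∂μ, x ∈ S) (hνS : ∀ᵐ x ∂ν, x ∈ S)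
    {g k : ℝ → ENNReal} (hμ : ∀ ε, ∀ x ∈ S, μ (Metric.ball x ε) = g ε)
    (hν : ∀ ε, ∀ x ∈ S, ν (Metric.ball x ε) = k ε) :
    ν Set.univ • μ = μ Set.univ • ν := by
  have := μ.smul_finite (measure_ne_top ν Set.univ)
  have := ν.smul_finite (measure_ne_top μ Set.univ)
  refine Measure.OuterRegular.ext_isOpen fun U hU => ?_
  have h₁ := measure_isOpen_mul_le_of_uniform_balls hμS hνS hμ hν hU
  have h₂ := measure_isOpen_mul_le_of_uniform_balls hνS hμS hν hμ hU
  simp only [Measure.smul_apply, smul_eq_mul]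
  rw [mul_comm, mul_comm (μ Set.univ)]
  exact le_antisymm h₂ h₁

lemma hausdorffMeasure_sphere_ne_zero (n : ℕ) {r : ℝ} (hr : 0 < r) :
    μH[(n : ℝ)] (Metric.sphere (0 : EuclideanSpace ℝ (Fin (n + 1))) r) ≠ 0 := by
  intro h0
  let f : EuclideanSpace ℝ (Fin (n + 1)) → Fin n → ℝ := fun x i => x i.succ
  have hf : LipschitzWith 1 f := by
    refine LipschitzWith.of_dist_le_mul fun x y => ?_
    rw [NNReal.coe_one, one_mul, dist_pi_le_iff dist_nonneg]
    intro i
    rw [dist_eq_norm, dist_eq_norm]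
    simpa [f] using PiLp.norm_apply_le (x - y) i.succ
  have hsub : {y : Fin n → ℝ | ∑ i, y i ^ 2 < r ^ 2} ⊆ f '' Metric.sphere 0 r := by
    intro y hy
    refine ⟨WithLp.toLp 2 (Fin.cons (√(r ^ 2 - ∑ i, y i ^ 2)) y), ?_, ?_⟩
    · rw [mem_sphere_zero_iff_norm, EuclideanSpace.norm_eq, Fin.sum_univ_succ]
      have : 0 ≤ r ^ 2 - ∑ i, y i ^ 2 := sub_nonneg.2 (le_of_lt hy)
      simp [Real.sq_sqrt this, hr.le]
    · ext i
      simp [f]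
  have hpos : 0 < volume {y : Fin n → ℝ | ∑ i, y i ^ 2 < r ^ 2} :=
    (isOpen_lt (by fun_prop) continuous_const).measure_pos _ ⟨0, by simpa using pow_pos hr 2⟩
  have hle := (measure_mono hsub).trans
    (hf.hausdorffMeasure_image_le (Nat.cast_nonneg n) (Metric.sphere 0 r))
  have hvol : (μH[(n : ℝ)] : Measure (Fin n → ℝ)) = volume := by
    simpa using hausdorffMeasure_pi_real (ι := Fin n)
  rw [h0, mul_zero, hvol] at hle
  exact hpos.ne' (le_antisymm hle bot_le)

lemma norm_inv_norm_smul_sub_le {E : Type*} [NormedAddCommGroup E] [NormedSpace ℝ E] {x y : E}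
    (hx : 1 ≤ ‖x‖) (hy : 1 ≤ ‖y‖) : ‖‖x‖⁻¹ • x - ‖y‖⁻¹ • y‖ ≤ 2 * ‖x - y‖ := by
  have hx0 : 0 < ‖x‖ := by linarith
  have hy0 : 0 < ‖y‖ := by linarith
  have hdec : ‖x‖⁻¹ • x - ‖y‖⁻¹ • y = ‖x‖⁻¹ • ((x - y) + ((‖y‖ - ‖x‖) * ‖y‖⁻¹) • y) := by
    rw [smul_add, smul_sub, smul_smul]
    have : ‖x‖⁻¹ * ((‖y‖ - ‖x‖) * ‖y‖⁻¹) = ‖x‖⁻¹ - ‖y‖⁻¹ := by field_simp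
    rw [this, sub_smul]
    abel
  rw [hdec, norm_smul, norm_inv, norm_norm]
  have h₁ : ‖(x - y) + ((‖y‖ - ‖x‖) * ‖y‖⁻¹) • y‖ ≤ 2 * ‖x - y‖ := by
    refine (norm_add_le _ _).trans ?_
    rw [norm_smul, norm_mul, norm_inv, norm_norm, mul_assoc, inv_mul_cancel₀ hy0.ne', mul_one,
      Real.norm_eq_abs, abs_sub_comm]
    linarith [abs_norm_sub_norm_le x y]
  calc ‖x‖⁻¹ * _ ≤ 1 * _ := by gcongr; exact inv_le_one_of_one_le₀ hx
    _ ≤ _ := by rw [one_mul]; exact h₁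

lemma hausdorffMeasure_sphere_ne_top (n : ℕ) {r : ℝ} (hr : 0 < r) :
    μH[(n : ℝ)] (Metric.sphere (0 : EuclideanSpace ℝ (Fin (n + 1))) r) ≠ ⊤ := by
  let e : Fin (n + 1) → ℝ → (Fin n → ℝ) → EuclideanSpace ℝ (Fin (n + 1)) :=
    fun i s y => WithLp.toLp 2 (i.insertNth s y)
  let F : Fin (n + 1) → ℝ → (Fin n → ℝ) → EuclideanSpace ℝ (Fin (n + 1)) :=
    fun i s y => r • (‖e i s y‖⁻¹ • e i s y)
  have he : ∀ i s, |s| = 1 → ∀ y, 1 ≤ ‖e i s y‖ := fun i s hs y => by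
    have := PiLp.norm_apply_le (e i s y) i
    simpa [e, hs] using this
  obtain ⟨K, hK⟩ : ∃ K : NNReal, ∀ i s, LipschitzWith K (e i s) := by
    refine ⟨_, fun i s => (PiLp.lipschitzWith_toLp 2 (fun _ : Fin (n + 1) => ℝ)).comp
      (LipschitzWith.of_dist_le_mul (K := 1) fun x y => ?_)⟩
    rw [NNReal.coe_one, one_mul, dist_pi_le_iff dist_nonneg]
    intro j
    refine Fin.succAboveCases i ?_ (fun j => ?_) j
    · simp
    · simpa using dist_le_pi_dist x y j
  have hF : ∀ i s, |s| = 1 → LipschitzWith (r.toNNReal * (2 * K)) (F i s) := fun i s hs => by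
    refine LipschitzWith.of_dist_le_mul fun x y => ?_
    rw [dist_eq_norm, ← smul_sub, norm_smul, Real.norm_of_nonneg hr.le]
    push_cast
    rw [Real.coe_toNNReal r hr.le, mul_assoc, mul_assoc]
    gcongr
    refine (norm_inv_norm_smul_sub_le (he i s hs x) (he i s hs y)).trans ?_
    gcongr
    simpa [dist_eq_norm] using (hK i s).dist_le_mul x y
  have hvol : (μH[(n : ℝ)] : Measure (Fin n → ℝ)) = volume := by
    simpa using hausdorffMeasure_pi_real (ι := Fin n)
  have hfin : ∀ i s, |s| = 1 → μH[(n : ℝ)] (F i s '' Metric.closedBall 0 1) < ⊤ :=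
    fun i s hs => by
      refine ((hF i s hs).hausdorffMeasure_image_le (Nat.cast_nonneg n) _).trans_lt ?_
      rw [hvol]
      exact ENNReal.mul_lt_top (ENNReal.rpow_lt_top_of_nonneg (Nat.cast_nonneg n)
        ENNReal.coe_ne_top) measure_closedBall_lt_top
  have hcover : Metric.sphere (0 : EuclideanSpace ℝ (Fin (n + 1))) r ⊆
      ⋃ i, (F i 1 '' Metric.closedBall 0 1 ∪ F i (-1) '' Metric.closedBall 0 1) := by
    intro x hx
    rw [mem_sphere_zero_iff_norm] at hx
    obtain ⟨i, -, hi⟩ := Finset.exists_max_image Finset.univ (fun j => |x j|)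
      Finset.univ_nonempty
    have hxi : 0 < |x i| := by
      by_contra hcon
      have : x = 0 := by
        ext j
        exact abs_eq_zero.1 (le_antisymm ((hi j (Finset.mem_univ j)).trans (not_lt.1 hcon))
          (abs_nonneg _))
      simp [this] at hx
      exact hr.ne hx
    have hmem : ∀ s, x i = |x i| * s → x ∈ F i s '' Metric.closedBall 0 1 := fun s hs => by
      refine ⟨fun j => |x i|⁻¹ * x (i.succAbove j), ?_, ?_⟩
      · rw [mem_closedBall_zero_iff, pi_norm_le_iff_of_nonneg zero_le_one]
        intro j
        rw [norm_mul, norm_inv, Real.norm_eq_abs, abs_abs, Real.norm_eq_abs,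
          inv_mul_le_iff₀ hxi, mul_one]
        exact hi _ (Finset.mem_univ _)
      · have hex : e i s (fun j => |x i|⁻¹ * x (i.succAbove j)) = |x i|⁻¹ • x := by
          ext j
          refine Fin.succAboveCases i ?_ (fun j => ?_) j
          · simp only [e, Fin.insertNth_apply_same, PiLp.smul_apply, smul_eq_mul]
            rw [eq_inv_mul_iff_mul_eq₀ hxi.ne', ← hs]
          · simp [e]
        simp only [F, hex]
        rw [norm_smul, norm_inv, Real.norm_eq_abs, abs_abs, hx, smul_smul, smul_smul]
        have : r * (|x i|⁻¹ * r)⁻¹ * |x i|⁻¹ = 1 := by field_simp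
        rw [this, one_smul]
    refine Set.mem_iUnion.2 ⟨i, ?_⟩
    rcases abs_cases (x i) with ⟨h, -⟩ | ⟨h, -⟩
    · exact Or.inl (hmem 1 (by rw [mul_one, h]))
    · exact Or.inr (hmem (-1) (by rw [h]; ring))
  refine ((measure_mono hcover).trans_lt ?_).ne
  refine (measure_iUnion_le _).trans_lt ?_
  rw [tsum_fintype]
  exact ENNReal.sum_lt_top.2 fun i _ => measure_union_lt_top (hfin i 1 (by simp))
    (hfin i (-1) (by simp))

/-- The measure `Measure.toSphere` transported to the sphere of radius `r` gives the same mass to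
all balls of equal radius centred on that sphere. -/
lemma map_smul_toSphere_ball_eq {E : Type*} [NormedAddCommGroup E] [InnerProductSpace ℝ E]
    [FiniteDimensional ℝ E] [MeasurableSpace E] [BorelSpace E] (r ε : ℝ) {x y : E}
    (hxy : ‖x‖ = ‖y‖) :
    (volume : Measure E).toSphere.map (fun z : Metric.sphere (0 : E) 1 => r • (z : E)) (Metric.ball x ε) =
      (volume : Measure E).toSphere.map (fun z : Metric.sphere (0 : E) 1 => r • (z : E)) (Metric.ball y ε) := by
  have hmeas : Measurable fun z : Metric.sphere (0 : E) 1 => r • (z : E) := by fun_prop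
  let R : E ≃ₗᵢ[ℝ] E := Submodule.reflection (ℝ ∙ (x - y))ᗮ
  have hR : R x = y := Submodule.reflection_sub hxy
  symm
  rw [Measure.map_apply hmeas measurableSet_ball, Measure.map_apply hmeas measurableSet_ball,
    Measure.toSphere_apply' _ (hmeas measurableSet_ball),
    Measure.toSphere_apply' _ (hmeas measurableSet_ball),
    ← R.measurePreserving.measure_preimage_equiv (f := R.toMeasurableEquiv)]
  congr 2
  ext w
  have hdist : ∀ z : E, dist (r • R z) y = dist (r • z) x := fun z => by
    rw [← hR, ← map_smul, R.dist_map]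
  refine Iff.symm ⟨?_, ?_⟩
  · rintro ⟨t, ht, _, ⟨z, hz, rfl⟩, rfl⟩
    refine ⟨t, ht, R z, ⟨⟨R z, by simp⟩, ?_, rfl⟩, (map_smul R t (z : E)).symm⟩
    simpa [hdist] using hz
  · rintro ⟨t, ht, _, ⟨z, hz, rfl⟩, hw⟩
    refine ⟨t, ht, R.symm z, ⟨⟨R.symm z, by simp⟩, ?_, rfl⟩, ?_⟩
    · have := hdist (R.symm z)
      rw [R.apply_symm_apply] at this
      simpa [← this] using hz
    · apply R.injective
      simpa using hw

/-- Hausdorff measure on a Euclidean sphere is a positive multiple of `Measure.toSphere`. -/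
lemma exists_sphereMeasure_eq_smul_map_toSphere (n : ℕ) {r : ℝ} (hr : 0 < r) :
    ∃ c : ENNReal, c ≠ 0 ∧ c ≠ ⊤ ∧ sphereMeasure (n + 1) r =
      c • (volume : Measure (EuclideanSpace ℝ (Fin (n + 1)))).toSphere.map
        (fun z : Metric.sphere (0 : EuclideanSpace ℝ (Fin (n + 1))) 1 =>
          r • (z : EuclideanSpace ℝ (Fin (n + 1)))) := by
  have hmeas : Measurable fun z : Metric.sphere (0 : EuclideanSpace ℝ (Fin (n + 1))) 1 =>
    r • (z : EuclideanSpace ℝ (Fin (n + 1))) := by fun_prop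
  have hS : sphereMeasure (n + 1) r = (μH[(n : ℝ)]).restrict (Metric.sphere 0 r) := by
    simp [sphereMeasure]
  rw [hS]
  set S : Set (EuclideanSpace ℝ (Fin (n + 1))) := Metric.sphere 0 r
  set μ : Measure (EuclideanSpace ℝ (Fin (n + 1))) := (μH[(n : ℝ)]).restrict S with hμ
  set ν := (volume : Measure (EuclideanSpace ℝ (Fin (n + 1)))).toSphere.map
        (fun z : Metric.sphere (0 : EuclideanSpace ℝ (Fin (n + 1))) 1 =>
          r • (z : EuclideanSpace ℝ (Fin (n + 1)))) with hν
  have hSm : MeasurableSet S := Metric.isClosed_sphere.measurableSet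
  have hμuniv : μ Set.univ = μH[(n : ℝ)] S := by rw [hμ, Measure.restrict_apply_univ]
  have : IsFiniteMeasure μ := ⟨by
    rw [hμuniv]; exact (hausdorffMeasure_sphere_ne_top n hr).lt_top⟩
  have : IsFiniteMeasure ν := by rw [hν]; infer_instance
  have hν0 : ν Set.univ ≠ 0 := by
    rw [hν, Measure.map_apply hmeas .univ, Set.preimage_univ, Ne, Measure.measure_univ_eq_zero]
    exact Measure.toSphere_ne_zero _
  have hμS : ∀ᵐ x ∂μ, x ∈ S := ae_restrict_mem hSm
  have hνS : ∀ᵐ x ∂ν, x ∈ S := by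
    refine (ae_map_iff hmeas.aemeasurable hSm).2 ?_
    exact .of_forall fun z => by simp [norm_smul, hr.le]
  obtain ⟨p, hp⟩ : S.Nonempty := NormedSpace.sphere_nonempty.2 hr.le
  have hμball : ∀ ε, ∀ x ∈ S, μ (Metric.ball x ε) = μ (Metric.ball p ε) := fun ε x hx => by
    have hxp : ‖x‖ = ‖p‖ := by rw [mem_sphere_zero_iff_norm.1 hx, mem_sphere_zero_iff_norm.1 hp]
    let R := Submodule.reflection (ℝ ∙ (x - p))ᗮ
    have hR : R x = p := Submodule.reflection_sub hxp
    rw [hμ, Measure.restrict_apply measurableSet_ball, Measure.restrict_apply measurableSet_ball,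
      ← R.toIsometryEquiv.hausdorffMeasure_preimage _ (Metric.ball p ε ∩ S)]
    congr 1
    ext w
    simp only [S, ← hR, Set.mem_inter_iff, Set.mem_preimage, Metric.mem_ball,
      mem_sphere_zero_iff_norm, LinearIsometryEquiv.coe_toIsometryEquiv,
      LinearIsometryEquiv.dist_map, LinearIsometryEquiv.norm_map]
  have hνball : ∀ ε, ∀ x ∈ S, ν (Metric.ball x ε) = ν (Metric.ball p ε) := fun ε x hx =>
    map_smul_toSphere_ball_eq r ε
      (by rw [mem_sphere_zero_iff_norm.1 hx, mem_sphere_zero_iff_norm.1 hp])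
  have key := measure_smul_eq_of_uniform_balls hμS hνS hμball hνball
  have hνtop : ν Set.univ ≠ ⊤ := measure_ne_top _ _
  refine ⟨(ν Set.univ)⁻¹ * μ Set.univ, ?_, ?_, ?_⟩
  · rw [hμuniv]
    exact mul_ne_zero (ENNReal.inv_ne_zero.2 hνtop) (hausdorffMeasure_sphere_ne_zero n hr)
  · exact ENNReal.mul_ne_top (ENNReal.inv_ne_top.2 hν0) (measure_ne_top _ _)
  · rw [mul_smul, ← key, smul_smul, ENNReal.inv_mul_cancel hν0 hνtop, one_smul]

/-- Integration in polar coordinates. -/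
lemma integral_eq_integral_Ioi_toSphere {E : Type*} [NormedAddCommGroup E] [NormedSpace ℝ E]
    [FiniteDimensional ℝ E] [Nontrivial E] [MeasurableSpace E] [BorelSpace E] (μ : Measure E)
    [μ.IsAddHaarMeasure] {f : E → ℝ} (hf : Integrable f μ) :
    ∫ x, f x ∂μ = ∫ t in Set.Ioi (0 : ℝ),
      t ^ (Module.finrank ℝ E - 1) * ∫ z : Metric.sphere (0 : E) 1, f (t • (z : E)) ∂μ.toSphere := by
  let e := homeomorphUnitSphereProd E
  let G : Metric.sphere (0 : E) 1 × Set.Ioi (0 : ℝ) → ℝ := fun p => f (p.2.1 • p.1.1)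
  have hG : ∀ x : ({0}ᶜ : Set E), G (e x) = f x := fun x => by
    have : (e.symm (e x)).1 = x := by rw [e.symm_apply_apply]
    rw [← this]
    rfl
  have hmp := μ.measurePreserving_homeomorphUnitSphereProd
  have hint : Integrable G (μ.toSphere.prod (.volumeIoiPow (Module.finrank ℝ E - 1))) := by
    rw [← hmp.integrable_comp_emb (Homeomorph.measurableEmbedding _)]
    have : G ∘ e = f ∘ Subtype.val := funext hG
    rw [this, ← integrableOn_iff_comap_subtypeVal (by measurability)]
    exact hf.integrableOn
  calc ∫ x, f x ∂μ = ∫ x : ({0}ᶜ : Set E), f x ∂(μ.comap (↑)) := by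
        rw [integral_subtype_comap (measurableSet_singleton _).compl f, restrict_compl_singleton]
    _ = ∫ p, G p ∂μ.toSphere.prod (.volumeIoiPow (Module.finrank ℝ E - 1)) := by
        rw [← hmp.integral_comp (Homeomorph.measurableEmbedding _)]
        exact integral_congr_ae (.of_forall fun x => (hG x).symm)
    _ = ∫ t : Set.Ioi (0 : ℝ), ∫ z : Metric.sphere (0 : E) 1, f (t.1 • (z : E)) ∂μ.toSphere
          ∂.volumeIoiPow (Module.finrank ℝ E - 1) := integral_prod_symm _ hint
    _ = _ := by
        simp only [Measure.volumeIoiPow, ENNReal.ofReal]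
        rw [integral_withDensity_eq_integral_smul,
          integral_subtype_comap measurableSet_Ioi fun t : ℝ =>
            Real.toNNReal (t ^ (Module.finrank ℝ E - 1)) •
              ∫ z : Metric.sphere (0 : E) 1, f (t • (z : E)) ∂μ.toSphere]
        · refine setIntegral_congr_fun measurableSet_Ioi fun t ht => ?_
          simp only [NNReal.smul_def, Real.coe_toNNReal _ (pow_nonneg (le_of_lt ht) _),
            smul_eq_mul]
        · exact (measurable_subtype_coe.pow_const _).real_toNNReal

lemma continuous_vand {β : ℝ} (hβ : 0 ≤ β) (N : ℕ) : Continuous (vand β N) := by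
  unfold vand
  refine continuous_finsetProd _ fun p _ => ?_
  exact Continuous.rpow_const (by fun_prop) fun _ => Or.inr hβ

/-- The Vandermonde factor is homogeneous of degree `N_β - N`. -/
lemma vand_smul {β t : ℝ} (ht : 0 < t) (N : ℕ) (x : Fin N → ℝ) :
    vand β N (fun i => t * x i) = t ^ (Nbeta β N - N) * vand β N x := by
  have hfac : ∀ p : Fin N × Fin N, |t * x p.1 - t * x p.2| ^ β = t ^ β * |x p.1 - x p.2| ^ β :=
    fun p => by
      rw [← mul_sub, abs_mul, abs_of_pos ht, Real.mul_rpow ht.le (abs_nonneg _)]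
  have hdeg : Nbeta β N - N =
      β * ((Finset.univ.filter fun p : Fin N × Fin N => p.1 < p.2).card : ℝ) := by
    rw [Fintype.card_product_filter_lt, Fintype.card_fin, Nat.cast_choose_two, Nbeta]
    ring
  simp only [vand, hfac, Finset.prod_mul_distrib, Finset.prod_const]
  rw [hdeg, Real.rpow_mul ht.le, Real.rpow_natCast]

/-- The average of a function against the bounded trace weight, in polar coordinates. -/
lemma integral_indicator_vand_mul {β : ℝ} (hβ : 0 ≤ β) (n : ℕ) {r : ℝ} (hr : 0 < r)
    {h : (Fin (n + 1) → ℝ) → ℝ} (hm : Measurable h) (hb : ∃ C, ∀ x, |h x| ≤ C) :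
    ∫ x : Fin (n + 1) → ℝ, Set.indicator {z : Fin (n + 1) → ℝ | ∑ i, z i ^ 2 ≤ r ^ 2}
        (vand β (n + 1)) x * h x =
      ∫ t in (0 : ℝ)..r, t ^ (Nbeta β (n + 1) - 1) *
        ∫ z : Metric.sphere (0 : EuclideanSpace ℝ (Fin (n + 1))) 1,
          vand β (n + 1) z.1 * h (fun i => t * z.1 i) ∂(volume : Measure _).toSphere := by
  obtain ⟨C, hC⟩ := hb
  let E := EuclideanSpace ℝ (Fin (n + 1))
  let B : Set E := Metric.closedBall 0 r
  let f : E → ℝ := B.indicator fun x => vand β (n + 1) x * h x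
  have hBm : MeasurableSet B := Metric.isClosed_closedBall.measurableSet
  have hvc : Continuous fun x : E => vand β (n + 1) x :=
    (continuous_vand hβ _).comp (PiLp.continuous_ofLp 2 _)
  have hhm : Measurable fun x : E => h x := hm.comp (PiLp.continuous_ofLp 2 _).measurable
  have hmemB : ∀ x : E, x ∈ B ↔ ∑ i, x i ^ 2 ≤ r ^ 2 := fun x => by
    rw [mem_closedBall_zero_iff, ← EuclideanSpace.real_norm_sq_eq,
      sq_le_sq₀ (norm_nonneg _) hr.le]
  have hf : Integrable f := by
    rw [integrable_indicator_iff hBm]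
    have hvi : IntegrableOn (fun x : E => vand β (n + 1) x) B :=
      hvc.continuousOn.integrableOn_compact (isCompact_closedBall _ _)
    exact hvi.mul_bdd (c := C) hhm.aestronglyMeasurable (.of_forall fun x => hC x)
  have hleft : ∫ x : Fin (n + 1) → ℝ, Set.indicator {z : Fin (n + 1) → ℝ | ∑ i, z i ^ 2 ≤ r ^ 2}
      (vand β (n + 1)) x * h x = ∫ x : E, f x := by
    rw [← (PiLp.volume_preserving_ofLp (Fin (n + 1))).integral_comp
      (MeasurableEquiv.toLp 2 (Fin (n + 1) → ℝ)).symm.measurableEmbedding]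
    refine integral_congr_ae (.of_forall fun x => ?_)
    by_cases hx : ∑ i, x i ^ 2 ≤ r ^ 2
    · simp [f, Set.indicator, hmemB, hx]
    · simp [f, Set.indicator, hmemB, hx]
  rw [hleft, integral_eq_integral_Ioi_toSphere volume hf, finrank_euclideanSpace_fin,
    Nat.add_sub_cancel, intervalIntegral.integral_of_le hr.le, ← Set.Ioi_inter_Iic,
    ← setIntegral_indicator measurableSet_Iic]
  refine setIntegral_congr_fun measurableSet_Ioi fun t (ht : 0 < t) => ?_
  have hnorm : ∀ z : Metric.sphere (0 : E) 1, t • (z : E) ∈ B ↔ t ≤ r := fun z => by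
    simp [B, norm_smul, abs_of_pos ht]
  by_cases htr : t ≤ r
  · have hval : ∀ z : Metric.sphere (0 : E) 1, f (t • (z : E)) =
        t ^ (Nbeta β (n + 1) - (n + 1 : ℕ)) *
          (vand β (n + 1) z.1 * h (fun i => t * z.1 i)) := fun z => by
      rw [← mul_assoc, ← vand_smul ht]
      simp only [f, Set.indicator_of_mem ((hnorm z).2 htr)]
      rfl
    simp only [hval, integral_const_mul, Set.indicator_of_mem (Set.mem_Iic.2 htr)]
    rw [← mul_assoc, ← Real.rpow_natCast, ← Real.rpow_add ht]
    congr 2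
    push_cast
    ring
  · have hval : ∀ z : Metric.sphere (0 : E) 1, f (t • (z : E)) = 0 := fun z =>
      Set.indicator_of_notMem (fun hz => htr ((hnorm z).1 hz)) _
    simp [hval, htr]

/-- Integrals against the fixed trace weight, up to a constant, as integrals over the unit
sphere. -/
lemma exists_integral_sphereMeasure_eq {β : ℝ} (hβ : 0 ≤ β) (n : ℕ) {r : ℝ} (hr : 0 < r) :
    ∃ a : ℝ, a ≠ 0 ∧ ∀ g : (Fin (n + 1) → ℝ) → ℝ, Measurable g →
      ∫ x, vand β (n + 1) x * g x ∂(sphereMeasure (n + 1) r) =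
        a * ∫ z : Metric.sphere (0 : EuclideanSpace ℝ (Fin (n + 1))) 1,
          vand β (n + 1) z.1 * g (fun i => r * z.1 i) ∂(volume : Measure _).toSphere := by
  obtain ⟨c, hc0, hctop, hc⟩ := exists_sphereMeasure_eq_smul_map_toSphere n hr
  refine ⟨c.toReal * r ^ (Nbeta β (n + 1) - (n + 1 : ℕ)),
    mul_ne_zero (ENNReal.toReal_ne_zero.2 ⟨hc0, hctop⟩) (Real.rpow_pos_of_pos hr _).ne',
    fun g hg => ?_⟩
  have hofLp : Measurable fun x : EuclideanSpace ℝ (Fin (n + 1)) => (x : Fin (n + 1) → ℝ) :=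
    (PiLp.continuous_ofLp 2 _).measurable
  have hvg : Measurable fun x : EuclideanSpace ℝ (Fin (n + 1)) => vand β (n + 1) x * g x :=
    ((continuous_vand hβ _).measurable.comp hofLp).mul (hg.comp hofLp)
  rw [hc, integral_smul_measure, integral_map (by fun_prop) hvg.aestronglyMeasurable,
    smul_eq_mul, mul_assoc, ← integral_const_mul (r ^ _)]
  congr 1
  refine integral_congr_ae (.of_forall fun z => ?_)
  simp only
  rw [← mul_assoc, ← vand_smul hr]
  rfl

/-- The bounded trace ensemble average is the radial average of rescaled fixed
trace ensemble averages. -/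
theorem bounded_trace_average_eq (β : ℝ) (hβ : β = 1 ∨ β = 2 ∨ β = 4)
    (N : ℕ) (hN : 1 ≤ N) (r : ℝ) (hr : 0 < r)
    (h : (Fin N → ℝ) → ℝ) (hm : Measurable h) (hb : ∃ C, ∀ x, |h x| ≤ C) :
    (Zbt β N r)⁻¹ *
        (∫ x : Fin N → ℝ,
          Set.indicator {z : Fin N → ℝ | ∑ i, z i ^ 2 ≤ r ^ 2} (vand β N) x * h x) =
      ∫ u in (0:ℝ)..r,
        (Nbeta β N / r ^ (Nbeta β N)) * u ^ (Nbeta β N - 1) *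
          ((Zft β N r)⁻¹ *
            ∫ x, vand β N x * h (fun i => (u / r) * x i) ∂(sphereMeasure N r)) := by
  obtain ⟨n, rfl⟩ : ∃ n, N = n + 1 := ⟨N - 1, by omega⟩
  have hβ0 : 0 ≤ β := by rcases hβ with rfl | rfl | rfl <;> norm_num
  have hNβ : 0 < Nbeta β (n + 1) := by
    unfold Nbeta
    push_cast
    rw [add_sub_cancel_right]
    positivity
  let σ := (volume : Measure (EuclideanSpace ℝ (Fin (n + 1)))).toSphere
  let I : ℝ := ∫ z, vand β (n + 1) z.1 ∂σ
  obtain ⟨a, ha, hft⟩ := exists_integral_sphereMeasure_eq hβ0 n hr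
  have hZft : Zft β (n + 1) r = a * I := by
    simpa [Zft, I, σ] using hft (fun _ => 1) measurable_const
  have hZbt : Zbt β (n + 1) r = r ^ Nbeta β (n + 1) / Nbeta β (n + 1) * I := by
    have := integral_indicator_vand_mul hβ0 n hr (h := fun _ => 1) measurable_const
      ⟨1, by simp⟩
    simp only [mul_one, intervalIntegral.integral_mul_const] at this
    rw [Zbt, this, integral_rpow (Or.inl (by linarith)), sub_add_cancel,
      Real.zero_rpow hNβ.ne', sub_zero]
  have hscale : ∀ u : ℝ, ∫ x, vand β (n + 1) x * h (fun i => u / r * x i)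
      ∂(sphereMeasure (n + 1) r) =
        a * ∫ z, vand β (n + 1) z.1 * h (fun i => u * z.1 i) ∂σ := fun u => by
    rw [hft (fun x => h fun i => u / r * x i) (hm.comp (by fun_prop))]
    simp only [← mul_assoc, div_mul_cancel₀ u hr.ne']
    rfl
  rw [integral_indicator_vand_mul hβ0 n hr hm hb, ← intervalIntegral.integral_const_mul]
  refine intervalIntegral.integral_congr fun u _ => ?_
  simp only [hscale, hZft, hZbt]
  rw [mul_inv, mul_inv, inv_div]
  field_simp
  rfl
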